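/- For every n ∈ ℕ there do not exist continuous maps a₀,…,a_n : S² → M₂(ℂ) such that each a_i(x) is self-adjoint, the values pairwise commute (a_i(x) a_j(x) = a_j(x) a_i(x) for all i, j and all x ∈ S²), each a_i is odd (u_x a_i(x) u_x = −a_i(x) for all x), and Σ_i a_i(x)² = 1 for every x ∈ S². (Hence the strong local-triviality dimension of the ℤ/2-action on C(S², M₂(ℂ)) by pointwise conjugation by u_x is infinite.) -/

import Mathlib

/-- The unit sphere `S² ⊆ ℝ³`. -/
def sphere2 : Set (Fin 3 → ℝ) := {x | x 0 ^ 2 + x 1 ^ 2 + x 2 ^ 2 = 1}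

/-- For `x = (x₁, x₂, x₃) ∈ S²`, the self-adjoint unitary
`u_x = [[x₃, x₁ - i·x₂], [x₁ + i·x₂, -x₃]] ∈ M₂(ℂ)`. -/
noncomputable def uMat (x : Fin 3 → ℝ) : Matrix (Fin 2) (Fin 2) ℂ :=
  !![(x 2 : ℂ), (x 0 : ℂ) - Complex.I * (x 1 : ℂ);
     (x 0 : ℂ) + Complex.I * (x 1 : ℂ), -(x 2 : ℂ)]

open Complex in
/-- A continuous nowhere zero function on the plane has a continuous logarithm. -/
lemma exists_log_plane (F : ℝ × ℝ → ℂ) (hF : Continuous F) (h0 : ∀ p, F p ≠ 0) :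
    ∃ G : ℝ × ℝ → ℂ, Continuous G ∧ ∀ p, Complex.exp (G p) = F p := by
  obtain ⟨f, ⟨-, hf⟩, -⟩ := isCoveringMapOn_exp.existsUnique_continuousMap_lifts
    (A := ℝ × ℝ) ⟨F, hF⟩ (a₀ := (0, 0)) (exp_log (h0 (0, 0))) (fun x ↦ h0 x)
  exact ⟨f, f.continuous, fun p => congrFun hf p⟩

/-- A continuous function with constant exponential is constant. -/
lemma const_of_exp_const {A : Type*} [TopologicalSpace A] [PreconnectedSpace A] (g : A → ℂ)
    (hg : Continuous g) (c : ℂ) (h : ∀ a, Complex.exp (g a) = c) (a a' : A) : g a = g a' :=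
  Complex.isCoveringMap_exp.const_of_comp hg (fun a a' => by simp [h]) a a'

/-- The winding number argument. -/
lemma no_homotopy (F : ℝ × ℝ → ℂ) (hF : Continuous F) (h0 : ∀ p, F p ≠ 0)
    (hper : ∀ s t, F (s, t + 2 * Real.pi) = F (s, t)) (s₀ s₁ : ℝ) (A B : ℂ)
    (hA : ∀ t : ℝ, F (s₀, t) = A * Complex.exp (-(2 * Complex.I * t)))
    (hB : ∀ t : ℝ, F (s₁, t) = B * Complex.exp (2 * Complex.I * t)) : False := by
  obtain ⟨G, hG, hGF⟩ := exists_log_plane F hF h0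
  have h1 := const_of_exp_const (fun p : ℝ × ℝ => G (p.1, p.2 + 2 * Real.pi) - G p)
    (by fun_prop) 1 (fun p => by
      rw [Complex.exp_sub, hGF, hGF, hper, div_self (h0 _)]) (s₀, 0) (s₁, 0)
  have h2 := const_of_exp_const (fun t : ℝ => G (s₀, t) + 2 * Complex.I * t)
    (by fun_prop) A (fun t => by
      rw [Complex.exp_add, hGF, hA, mul_assoc, ← Complex.exp_add]; simp) (2 * Real.pi) 0
  have h3 := const_of_exp_const (fun t : ℝ => G (s₁, t) - 2 * Complex.I * t)
    (by fun_prop) B (fun t => by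
      rw [Complex.exp_sub, hGF, hB, mul_div_assoc, div_self (Complex.exp_ne_zero _)]; simp)
      (2 * Real.pi) 0
  simp only [zero_add] at h1
  push_cast at h2 h3
  have h4 : (8 * Real.pi : ℂ) * Complex.I = 0 := by linear_combination h2 - h3 - h1
  simp [Real.pi_ne_zero] at h4

/-- Structure of an odd self-adjoint matrix. -/
lemma odd_structure (x : Fin 3 → ℝ) (hx : x ∈ sphere2) (a : Matrix (Fin 2) (Fin 2) ℂ)
    (hs : IsSelfAdjoint a) (ho : uMat x * a * uMat x = -a) :
    a 0 0 = ((a 0 0).re : ℂ) ∧ a 1 1 = -((a 0 0).re : ℂ) ∧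
    a 1 0 = ((a 1 0).re : ℂ) + ((a 1 0).im : ℂ) * Complex.I ∧
    a 0 1 = ((a 1 0).re : ℂ) - ((a 1 0).im : ℂ) * Complex.I ∧
    x 0 * (a 1 0).re + x 1 * (a 1 0).im + x 2 * (a 0 0).re = 0 := by
  have hx' : x 0 ^ 2 + x 1 ^ 2 + x 2 ^ 2 = 1 := hx
  have huu : uMat x * uMat x = 1 := by
    have hxc : (x 0 : ℂ) ^ 2 + (x 1 : ℂ) ^ 2 + (x 2 : ℂ) ^ 2 = 1 := by exact_mod_cast hx'
    ext i j
    fin_cases i <;> fin_cases j <;> simp [uMat, Matrix.mul_apply, Fin.sum_univ_two]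
    · linear_combination hxc - (x 1 : ℂ) ^ 2 * Complex.I_sq
    · ring
    · ring
    · linear_combination hxc - (x 1 : ℂ) ^ 2 * Complex.I_sq
  have hanti : uMat x * a = -(a * uMat x) := by
    calc uMat x * a = uMat x * a * (uMat x * uMat x) := by rw [huu, mul_one]
      _ = (uMat x * a * uMat x) * uMat x := by simp only [mul_assoc]
      _ = _ := by rw [ho, neg_mul]
  have htr : a.trace = 0 := by
    have h1 : (uMat x * a * uMat x).trace = a.trace := by
      rw [Matrix.trace_mul_comm, ← mul_assoc, huu, one_mul]
    rw [ho, Matrix.trace_neg] at h1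
    linear_combination (-1 / 2 : ℂ) * h1
  rw [Matrix.trace_fin_two] at htr
  have h00 : star (a 0 0) = a 0 0 := congrFun (congrFun hs 0) 0
  have h01 : star (a 1 0) = a 0 1 := congrFun (congrFun hs 0) 1
  have e00 : a 0 0 = ((a 0 0).re : ℂ) := (Complex.conj_eq_iff_re.mp h00).symm
  have e01 : a 0 1 = ((a 1 0).re : ℂ) - ((a 1 0).im : ℂ) * Complex.I := by
    rw [← h01]; apply Complex.ext <;> simp
  refine ⟨e00, ?_, (Complex.re_add_im _).symm, e01, ?_⟩
  · linear_combination htr - e00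
  · have h := congrArg Complex.re (congrFun (congrFun hanti 0) 0)
    rw [Matrix.neg_apply, Matrix.mul_apply, Matrix.mul_apply, Fin.sum_univ_two, Fin.sum_univ_two,
      e01] at h
    simp [uMat] at h
    linarith

/-- Point of the sphere in spherical coordinates. -/
noncomputable def sphPt (s t : ℝ) : Fin 3 → ℝ :=
  ![Real.sin s * Real.cos t, Real.sin s * Real.sin t, Real.cos s]

lemma sphPt_mem (s t : ℝ) : sphPt s t ∈ sphere2 := by
  simp only [sphere2, sphPt, Set.mem_ofPred_eq, Matrix.cons_val]
  linear_combination Real.sin s ^ 2 * Real.sin_sq_add_cos_sq t + Real.sin_sq_add_cos_sq s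

/-- Component of a matrix along the horizontal tangent vector. -/
noncomputable def compP (t : ℝ) (a : Matrix (Fin 2) (Fin 2) ℂ) : ℝ :=
  -(Real.sin t) * (a 1 0).re + Real.cos t * (a 1 0).im

/-- Component of a matrix along the vertical tangent vector. -/
noncomputable def compQ (s t : ℝ) (a : Matrix (Fin 2) (Fin 2) ℂ) : ℝ :=
  -(Real.cos s * Real.cos t) * (a 1 0).re - Real.cos s * Real.sin t * (a 1 0).im
    + Real.sin s * (a 0 0).re

/-- Complex component. -/
noncomputable def compC (s t : ℝ) (a : Matrix (Fin 2) (Fin 2) ℂ) : ℂ :=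
  (compP t a : ℂ) + (compQ s t a : ℂ) * Complex.I

lemma comp_sq (s t : ℝ) (a : Matrix (Fin 2) (Fin 2) ℂ)
    (h : sphPt s t 0 * (a 1 0).re + sphPt s t 1 * (a 1 0).im + sphPt s t 2 * (a 0 0).re = 0) :
    compP t a ^ 2 + compQ s t a ^ 2 = (a 1 0).re ^ 2 + (a 1 0).im ^ 2 + (a 0 0).re ^ 2 := by
  simp only [sphPt, Matrix.cons_val] at h
  unfold compP compQ
  generalize (a 1 0).re = p at *
  generalize (a 1 0).im = q at *
  generalize (a 0 0).re = r at *
  have hs := Real.sin_sq_add_cos_sq s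
  have ht := Real.sin_sq_add_cos_sq t
  generalize Real.sin s = S at *
  generalize Real.cos s = C at *
  generalize Real.sin t = U at *
  generalize Real.cos t = V at *
  linear_combination (p ^ 2 + q ^ 2) * ht + ((V * p + U * q) ^ 2 + r ^ 2) * hs -
    (S * V * p + S * U * q + C * r) * h

lemma comp_det (s t : ℝ) (x y : ↥sphere2) (a b : Matrix (Fin 2) (Fin 2) ℂ)
    (ha : IsSelfAdjoint a) (hb : IsSelfAdjoint b)
    (hao : uMat x.1 * a * uMat x.1 = -a) (hbo : uMat y.1 * b * uMat y.1 = -b)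
    (hab : a * b = b * a) :
    compP t a * compQ s t b = compQ s t a * compP t b := by
  obtain ⟨a00, a11, a10, a01, -⟩ := odd_structure x.1 x.2 a ha hao
  obtain ⟨b00, b11, b10, b01, -⟩ := odd_structure y.1 y.2 b hb hbo
  unfold compP compQ
  have h0 := congrArg Complex.im (congrFun (congrFun hab 0) 0)
  have h1 := congrFun (congrFun hab 1) 0
  simp only [Matrix.mul_apply, Fin.sum_univ_two] at h0 h1
  rw [a11, b11, a00, b00, a10, b10] at h1
  rw [a01, b01, a00, b00, a10, b10] at h0
  generalize (a 1 0).re = p at *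
  generalize (a 1 0).im = q at *
  generalize (a 0 0).re = r at *
  generalize (b 1 0).re = p' at *
  generalize (b 1 0).im = q' at *
  generalize (b 0 0).re = r' at *
  have h2 := congrArg Complex.re h1
  have h3 := congrArg Complex.im h1
  simp at h0 h2 h3
  have k0 : p * q' = q * p' := by linarith
  have k1 : p * r' = r * p' := by linarith
  have k2 : q * r' = r * q' := by linarith
  have ht := Real.sin_sq_add_cos_sq t
  linear_combination (Real.cos s * (Real.sin t ^ 2 + Real.cos t ^ 2)) * k0
    - Real.sin s * Real.sin t * k1 + Real.sin s * Real.cos t * k2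

lemma sq_entry (x : ↥sphere2) (a : Matrix (Fin 2) (Fin 2) ℂ)
    (ha : IsSelfAdjoint a) (hao : uMat x.1 * a * uMat x.1 = -a) :
    ((a ^ 2) 0 0).re = (a 1 0).re ^ 2 + (a 1 0).im ^ 2 + (a 0 0).re ^ 2 := by
  obtain ⟨a00, a11, a10, a01, -⟩ := odd_structure x.1 x.2 a ha hao
  rw [pow_two, Matrix.mul_apply, Fin.sum_univ_two, a01, a00]
  simp
  ring

/-- Sum of squares of collinear complex numbers does not vanish. -/
lemma sum_sq_ne_zero {ι : Type*} [Fintype ι] (P Q : ι → ℝ)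
    (hd : ∀ i j, P i * Q j = Q i * P j) (h1 : ∑ i, (P i ^ 2 + Q i ^ 2) = 1) :
    ∑ i, ((P i : ℂ) + (Q i : ℂ) * Complex.I) ^ 2 ≠ 0 := by
  intro h
  have key : (∑ i, ((P i : ℂ) + (Q i : ℂ) * Complex.I) ^ 2) *
      (∑ j, ((P j : ℂ) - (Q j : ℂ) * Complex.I) ^ 2) =
      (((∑ i, (P i ^ 2 + Q i ^ 2)) * (∑ j, (P j ^ 2 + Q j ^ 2)) : ℝ) : ℂ) := by
    push_cast
    rw [Finset.sum_mul_sum, Finset.sum_mul_sum]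
    refine Finset.sum_congr rfl fun i _ => Finset.sum_congr rfl fun j _ => ?_
    have hc : (P i : ℂ) * Q j = Q i * P j := by exact_mod_cast hd i j
    have e1 : ((P i : ℂ) + Q i * Complex.I) * ((P j : ℂ) - Q j * Complex.I)
        = P i * P j + Q i * Q j := by
      linear_combination -Complex.I * hc - (Q i : ℂ) * Q j * Complex.I_sq
    rw [← mul_pow, e1]
    linear_combination -((P i : ℂ) * Q j - Q i * P j) * hc
  rw [h, h1] at key
  simp at key

lemma continuous_compC_sq (b : ℝ × ℝ → Matrix (Fin 2) (Fin 2) ℂ)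
    (h10 : Continuous fun p => b p 1 0) (h00 : Continuous fun p => b p 0 0) :
    Continuous fun p : ℝ × ℝ => compC p.1 p.2 (b p) ^ 2 := by
  have aux : ∀ f g h : ℝ × ℝ → ℝ, Continuous f → Continuous g → Continuous h →
      Continuous fun p : ℝ × ℝ => (((-(Real.sin p.2) * f p + Real.cos p.2 * g p : ℝ) : ℂ) +
        ((-(Real.cos p.1 * Real.cos p.2) * f p - Real.cos p.1 * Real.sin p.2 * g p
          + Real.sin p.1 * h p : ℝ) : ℂ) * Complex.I) ^ 2 := by
    intro f g h hf hg hh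
    refine Continuous.pow (Continuous.add (Complex.continuous_ofReal.comp ?_)
      (Continuous.mul (Complex.continuous_ofReal.comp ?_) continuous_const)) 2
    · fun_prop
    · fun_prop
  exact aux _ _ _ (Complex.continuous_re.comp h10) (Complex.continuous_im.comp h10)
    (Complex.continuous_re.comp h00)

/-- For no `n` is there a family of continuous, odd, self-adjoint,
pairwise commuting maps `a₀, …, a_n : S² → M₂(ℂ)` with `Σᵢ aᵢ(x)² = 1` everywhere;
hence the strong local-triviality dimension of the `ℤ/2`-action on `C(S², M₂(ℂ))` by
pointwise conjugation by `u_x` is infinite. -/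
theorem stmt10 :
    ∀ n : ℕ, ¬ ∃ a : Fin (n + 1) → ↥sphere2 → Matrix (Fin 2) (Fin 2) ℂ,
      (∀ i, Continuous (a i)) ∧
      (∀ i x, IsSelfAdjoint (a i x)) ∧
      (∀ i j x, a i x * a j x = a j x * a i x) ∧
      (∀ i (x : ↥sphere2), uMat x.1 * a i x * uMat x.1 = -(a i x)) ∧
      (∀ x, (∑ i, a i x ^ 2) = 1) := by
  rintro n ⟨a, hc, hs, hcomm, ho, hsum⟩
  let X : ℝ × ℝ → ↥sphere2 := fun p => ⟨sphPt p.1 p.2, sphPt_mem p.1 p.2⟩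
  have hX : Continuous X := by
    refine Continuous.subtype_mk ?_ _
    refine continuous_pi fun i => ?_
    fin_cases i <;> simp [sphPt] <;> fun_prop
  have hent : ∀ i k l, Continuous fun p : ℝ × ℝ => a i (X p) k l := fun i k l =>
    ((hc i).comp hX).matrix_elem k l
  let F : ℝ × ℝ → ℂ := fun p => ∑ i, compC p.1 p.2 (a i (X p)) ^ 2
  have hF : Continuous F := by
    refine continuous_finsetSum _ fun i _ => ?_
    have h10 := hent i 1 0
    have h00 := hent i 0 0
    exact continuous_compC_sq (fun p => a i (X p)) h10 h00
  have h0 : ∀ p, F p ≠ 0 := by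
    intro p
    refine sum_sq_ne_zero (fun i => compP p.2 (a i (X p))) (fun i => compQ p.1 p.2 (a i (X p)))
      (fun i j => comp_det p.1 p.2 (X p) (X p) _ _ (hs i _) (hs j _) (ho i _) (ho j _)
        (hcomm i j _)) ?_
    have h := congrArg Complex.re (congrFun (congrFun (hsum (X p)) 0) 0)
    rw [Matrix.sum_apply, Complex.re_sum] at h
    simp only [Matrix.one_apply_eq, Complex.one_re] at h
    rw [← h]
    refine Finset.sum_congr rfl fun i _ => ?_
    rw [sq_entry (X p) _ (hs i _) (ho i _)]
    exact comp_sq _ _ _ (odd_structure (X p).1 (X p).2 _ (hs i _) (ho i _)).2.2.2.2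
  have hper : ∀ s t, F (s, t + 2 * Real.pi) = F (s, t) := by
    intro s t
    have hx : X (s, t + 2 * Real.pi) = X (s, t) := Subtype.ext (by simp [X, sphPt])
    simp only [F, hx, compC, compP, compQ, Real.sin_add_two_pi, Real.cos_add_two_pi]
  refine no_homotopy F hF h0 hper 0 Real.pi
    (∑ i, (((a i (X (0, 0)) 1 0).im : ℂ) - ((a i (X (0, 0)) 1 0).re : ℂ) * Complex.I) ^ 2)
    (∑ i, (((a i (X (Real.pi, 0)) 1 0).im : ℂ)
      + ((a i (X (Real.pi, 0)) 1 0).re : ℂ) * Complex.I) ^ 2) ?_ ?_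
  · intro t
    have hx : X (0, t) = X (0, 0) := Subtype.ext (by simp [X, sphPt])
    have he : Complex.exp (-(2 * Complex.I * t))
        = ((Real.cos t : ℂ) - Real.sin t * Complex.I) ^ 2 := by
      rw [show -(2 * Complex.I * (t : ℂ)) = ((2 : ℕ) : ℂ) * (((-t : ℝ) : ℂ) * Complex.I) by
        push_cast; ring, Complex.exp_nat_mul, Complex.exp_mul_I, ← Complex.ofReal_cos,
        ← Complex.ofReal_sin, Real.cos_neg, Real.sin_neg]
      push_cast; ring
    rw [he, Finset.sum_mul]
    refine Finset.sum_congr rfl fun i _ => ?_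
    simp only [hx, compC, compP, compQ, Real.cos_zero, Real.sin_zero]
    rw [← mul_pow]
    congr 1
    push_cast
    linear_combination -((a i (X (0, 0)) 1 0).re : ℂ) * Complex.sin t * Complex.I_sq
  · intro t
    have hx : X (Real.pi, t) = X (Real.pi, 0) := Subtype.ext (by simp [X, sphPt])
    have he : Complex.exp (2 * Complex.I * t)
        = ((Real.cos t : ℂ) + Real.sin t * Complex.I) ^ 2 := by
      rw [show (2 * Complex.I * (t : ℂ)) = ((2 : ℕ) : ℂ) * ((t : ℂ) * Complex.I) by
        push_cast; ring, Complex.exp_nat_mul, Complex.exp_mul_I, ← Complex.ofReal_cos,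
        ← Complex.ofReal_sin]
    rw [he, Finset.sum_mul]
    refine Finset.sum_congr rfl fun i _ => ?_
    simp only [hx, compC, compP, compQ, Real.cos_pi, Real.sin_pi]
    rw [← mul_pow]
    congr 1
    push_cast
    linear_combination -((a i (X (Real.pi, 0)) 1 0).re : ℂ) * Complex.sin t * Complex.I_sq
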